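/- (Theorem 2, ergodic O(1/N) rate.) Let (x^k, y^k)_{k∈ℕ} be generated by Algorithm 1 with β_k ≡ β > 0, δ ∈ (0,1), step sizes σ ≤ σ_k ≤ √(1+θ_{k−1})σ_{k−1} (σ > 0), θ_k = σ_k/σ_{k−1}, τ_k = βσ_k, metrics satisfying Assumption 1, and let (x̂, ŷ) be a saddle point. Set D := Π_{k∈ℕ}(1+η_k) < ∞, s_N := Σ_{k=1}^N σ_k, X̄^N := (Σ_{k=1}^N σ_k x^{k+1})/s_N, and Ȳ^N := (σ_1θ_1 y^0 + Σ_{k=1}^N σ_k ȳ^k)/(σ_1θ_1 + s_N). Then the primal–dual gap satisfies G_{x̂,ŷ}(X̄^N, Ȳ^N) ≤ (D/s_N)·( (1/(2β))‖x^1 − x̂‖²_{M_1} + ½‖y^1 − ŷ‖² + σ_1θ_1 D_{x̂,ŷ}(y^0) ); in particular, since s_N ≥ Nσ, G_{x̂,ŷ}(X̄^N, Ȳ^N) = O(1/N). -/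

import Mathlib

open scoped RealInnerProductSpace
open Filter Topology

/-- Convexity for extended-real-valued functions. -/
def ERealConvexOn {X : Type*} [AddCommGroup X] [Module ℝ X] (g : X → EReal) : Prop :=
  ∀ ⦃u v : X⦄ ⦃a b : ℝ⦄, 0 ≤ a → 0 ≤ b → a + b = 1 →
    g (a • u + b • v) ≤ (a : EReal) * g u + (b : EReal) * g v

/-- `p = prox^Q_{τg}(w)`: `p` minimizes `z ↦ g(z) + (1/(2τ))‖z − w‖²_Q`. -/
def IsProxPt {E : Type*} [NormedAddCommGroup E] [InnerProductSpace ℝ E]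
    (Q : E →L[ℝ] E) (τ : ℝ) (g : E → EReal) (w p : E) : Prop :=
  ∀ z : E,
    g p + ((1 / (2 * τ) * ⟪Q (p - w), p - w⟫ : ℝ) : EReal)
      ≤ g z + ((1 / (2 * τ) * ⟪Q (z - w), z - w⟫ : ℝ) : EReal)

/-- The value `⟨Kx, y⟩ + g(x) + h(x) − f*(y)` of the saddle-point problem. -/
noncomputable def saddleVal {X Y : Type*}
    [NormedAddCommGroup X] [InnerProductSpace ℝ X]
    [NormedAddCommGroup Y] [InnerProductSpace ℝ Y]
    (K : X →L[ℝ] Y) (g : X → EReal) (h : X → ℝ) (fs : Y → EReal)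
    (x : X) (y : Y) : EReal :=
  ((⟪K x, y⟫ : ℝ) : EReal) + g x + ((h x : ℝ) : EReal) - fs y

/-- `(xh, yh)` is a saddle point. -/
def IsSaddlePoint {X Y : Type*}
    [NormedAddCommGroup X] [InnerProductSpace ℝ X]
    [NormedAddCommGroup Y] [InnerProductSpace ℝ Y]
    (K : X →L[ℝ] Y) (g : X → EReal) (h : X → ℝ) (fs : Y → EReal)
    (xh : X) (yh : Y) : Prop :=
  ∀ (x : X) (y : Y),
    saddleVal K g h fs xh y ≤ saddleVal K g h fs xh yh ∧
    saddleVal K g h fs xh yh ≤ saddleVal K g h fs x yh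

/-- Primal gap function `P_{xh,yh}`. -/
noncomputable def Pgap {X Y : Type*}
    [NormedAddCommGroup X] [InnerProductSpace ℝ X] [FiniteDimensional ℝ X]
    [NormedAddCommGroup Y] [InnerProductSpace ℝ Y] [FiniteDimensional ℝ Y]
    (K : X →L[ℝ] Y) (g : X → EReal) (h : X → ℝ) (xh : X) (yh : Y) (x : X) : EReal :=
  g x + ((h x : ℝ) : EReal) - g xh - ((h xh : ℝ) : EReal)
    + ((⟪(ContinuousLinearMap.adjoint K) yh, x - xh⟫ : ℝ) : EReal)

/-- Dual gap function `D_{xh,yh}`. -/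
noncomputable def Dgap {X Y : Type*}
    [NormedAddCommGroup X] [InnerProductSpace ℝ X]
    [NormedAddCommGroup Y] [InnerProductSpace ℝ Y]
    (K : X →L[ℝ] Y) (fs : Y → EReal) (xh : X) (yh : Y) (y : Y) : EReal :=
  fs y - fs yh - ((⟪K xh, y - yh⟫ : ℝ) : EReal)

section

theorem ERealConvexOn.convexOn_toReal {E : Type*} [AddCommGroup E] [Module ℝ E] {f : E → EReal}
    (hf : ERealConvexOn f) (hbot : ∀ z, f z ≠ ⊥) :
    ConvexOn ℝ {z | f z ≠ ⊤} (fun z => (f z).toReal) := by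
  have key : ∀ ⦃u v : E⦄ ⦃a b : ℝ⦄, f u ≠ ⊤ → f v ≠ ⊤ → 0 ≤ a → 0 ≤ b → a + b = 1 →
      f (a • u + b • v) ≤ ((a * (f u).toReal + b * (f v).toReal : ℝ) : EReal) := by
    intro u v a b hu hv ha hb hab
    have := hf (u := u) (v := v) ha hb hab
    rw [← EReal.coe_toReal hu (hbot u), ← EReal.coe_toReal hv (hbot v)] at this
    exact_mod_cast this
  refine ⟨fun u hu v hv a b ha hb hab => ?_, fun u hu v hv a b ha hb hab => ?_⟩
  · exact ne_top_of_le_ne_top (EReal.coe_ne_top _) (key hu hv ha hb hab)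
  · have := EReal.toReal_le_toReal (key hu hv ha hb hab) (hbot _) (EReal.coe_ne_top _)
    exact_mod_cast this

theorem IsProxPt.ne_top {E : Type*} [NormedAddCommGroup E] [InnerProductSpace ℝ E]
    {Q : E →L[ℝ] E} {τ : ℝ} {f : E → EReal} {w p z : E} (hp : IsProxPt Q τ f w p)
    (hz : f z ≠ ⊤) : f p ≠ ⊤ := by
  intro htop
  have := hp z
  rw [htop, EReal.top_add_coe, top_le_iff] at this
  exact EReal.add_ne_top hz (EReal.coe_ne_top _) this

/-- Variational inequality characterizing a proximal point. -/
theorem IsProxPt.toReal_add_inner_le {E : Type*} [NormedAddCommGroup E] [InnerProductSpace ℝ E]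
    {Q : E →L[ℝ] E} {τ : ℝ} {f : E → EReal} {w p z : E} (hp : IsProxPt Q τ f w p)
    (hτ : 0 < τ) (hQ : ∀ u v : E, ⟪Q u, v⟫ = ⟪u, Q v⟫)
    (hf : ERealConvexOn f) (hbot : ∀ z, f z ≠ ⊥) (hz : f z ≠ ⊤) :
    (f p).toReal + 1 / τ * ⟪Q (w - p), z - p⟫ ≤ (f z).toReal := by
  have hpt : f p ≠ ⊤ := hp.ne_top hz
  have hconv := hf.convexOn_toReal hbot
  have hineq : ∀ t : ℝ, 0 < t → t ≤ 1 →
      (f p).toReal + 1 / τ * ⟪Q (w - p), z - p⟫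
        ≤ (f z).toReal + t * (1 / (2 * τ) * ⟪Q (z - p), z - p⟫) := by
    intro t ht ht1
    have hmem := hconv.1 hpt hz (sub_nonneg.2 ht1) ht.le (by ring)
    have hle := hconv.2 hpt hz (sub_nonneg.2 ht1) ht.le (by ring)
    have hmin := hp ((1 - t) • p + t • z)
    rw [← EReal.coe_toReal hpt (hbot p), ← EReal.coe_toReal hmem (hbot _)] at hmin
    have hmin' : (f p).toReal + 1 / (2 * τ) * ⟪Q (p - w), p - w⟫
        ≤ (f ((1 - t) • p + t • z)).toReal + 1 / (2 * τ) *
          ⟪Q ((1 - t) • p + t • z - w), (1 - t) • p + t • z - w⟫ := by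
      exact_mod_cast hmin
    have hexp : ⟪Q ((1 - t) • p + t • z - w), (1 - t) • p + t • z - w⟫
        = ⟪Q (p - w), p - w⟫ - 2 * t * ⟪Q (w - p), z - p⟫ + t ^ 2 * ⟪Q (z - p), z - p⟫ := by
      have h1 : (1 - t) • p + t • z - w = (p - w) + t • (z - p) := by module
      have h2 : w - p = -(p - w) := by abel
      have h3 : ⟪Q (z - p), p - w⟫ = ⟪Q (p - w), z - p⟫ := by
        rw [hQ, real_inner_comm]
      rw [h1, h2, map_add, map_smul, map_neg, inner_add_left, inner_add_right, inner_add_right,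
        real_inner_smul_left, real_inner_smul_left, real_inner_smul_right, real_inner_smul_right,
        inner_neg_left, h3]
      ring
    rw [hexp] at hmin'
    simp only [smul_eq_mul] at hle
    have h4 : 1 / (2 * τ) * (2 * t * ⟪Q (w - p), z - p⟫) = t * (1 / τ * ⟪Q (w - p), z - p⟫) := by
      field_simp
    refine le_of_mul_le_mul_left ?_ ht
    linear_combination hmin' + hle - h4
  have hlim : Tendsto (fun t : ℝ => (f z).toReal + t * (1 / (2 * τ) * ⟪Q (z - p), z - p⟫))
      (𝓝[>] 0) (𝓝 ((f z).toReal)) := by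
    have : Continuous (fun t : ℝ => (f z).toReal + t * (1 / (2 * τ) * ⟪Q (z - p), z - p⟫)) := by
      fun_prop
    simpa using (this.tendsto 0).mono_left nhdsWithin_le_nhds
  refine ge_of_tendsto hlim ?_
  filter_upwards [Ioc_mem_nhdsGT (zero_lt_one' ℝ)] with t ht using hineq t ht.1 ht.2

/-- A convex function lies above its tangent hyperplanes. -/
theorem ConvexOn.add_inner_gradient_le {E : Type*} [NormedAddCommGroup E] [InnerProductSpace ℝ E]
    [CompleteSpace E] {h : E → ℝ} (hh : ConvexOn ℝ Set.univ h) {u v : E}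
    (hv : HasGradientAt h v u) (z : E) : h u + ⟪v, z - u⟫ ≤ h z := by
  have hline : ConvexOn ℝ Set.univ (h ∘ AffineMap.lineMap (k := ℝ) u z) := by
    simpa using hh.comp_affineMap (AffineMap.lineMap (k := ℝ) u z)
  have hd : HasDerivAt (h ∘ AffineMap.lineMap (k := ℝ) u z) ⟪v, z - u⟫ 0 := by
    have h1 : HasFDerivAt h (InnerProductSpace.toDual ℝ E v)
        (AffineMap.lineMap (k := ℝ) u z (0 : ℝ)) := by
      simpa using hv.hasFDerivAt
    simpa using h1.comp_hasDerivAt (0 : ℝ) (AffineMap.hasDerivAt_lineMap (a := u) (b := z))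
  have := hline.le_slope_of_hasDerivAt (Set.mem_univ 0) (Set.mem_univ 1) zero_lt_one hd
  simp only [slope, sub_zero, inv_one, one_smul, vsub_eq_sub, Function.comp_apply,
    AffineMap.lineMap_apply_one, AffineMap.lineMap_apply_zero] at this
  linarith

/-- One-step energy estimate for the primal-dual iteration. -/
theorem primal_dual_step {X Y : Type*}
    [NormedAddCommGroup X] [InnerProductSpace ℝ X] [FiniteDimensional ℝ X]
    [NormedAddCommGroup Y] [InnerProductSpace ℝ Y] [FiniteDimensional ℝ Y]
    (K : X →L[ℝ] Y) (T : X →L[ℝ] X) (hT : ∀ u v : X, ⟪T u, v⟫ = ⟪u, T v⟫)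
    {x₀ x₁ xh v : X} {y₀ y₁ y₂ yb yh : Y} {G₁ Gh h₀ h₁ hh F₀ F₁ F₂ Fh σ' σ θ β : ℝ}
    (hσ' : 0 < σ') (hσ : 0 < σ) (hβ : 0 < β) (hθ : θ = σ / σ') (hyb : yb = y₁ + θ • (y₁ - y₀))
    (hG : G₁ + 1 / (β * σ) *
      ⟪T (x₀ - x₁) - (β * σ) • (ContinuousLinearMap.adjoint K) yb - (β * σ) • v, xh - x₁⟫ ≤ Gh)
    (hF₂ : F₁ + 1 / σ' * ⟪y₀ + σ' • K x₀ - y₁, y₂ - y₁⟫ ≤ F₂)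
    (hF₀ : F₁ + 1 / σ' * ⟪y₀ + σ' • K x₀ - y₁, y₀ - y₁⟫ ≤ F₀)
    (hFh : F₂ + 1 / σ * ⟪y₁ + σ • K x₁ - y₂, yh - y₂⟫ ≤ Fh)
    (hh₀ : h₀ + ⟪v, xh - x₀⟫ ≤ hh)
    (hls : (β * σ) * σ * ‖K x₁ - K x₀‖ ^ 2 + 2 * (β * σ) * (h₁ - h₀ - ⟪v, x₁ - x₀⟫)
      ≤ ⟪T (x₁ - x₀), x₁ - x₀⟫) :
    σ * (G₁ + h₁ - Gh - hh + ⟪(ContinuousLinearMap.adjoint K) yh, x₁ - xh⟫)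
        + σ * (1 + θ) * (F₁ - Fh - ⟪K xh, y₁ - yh⟫)
        - σ * θ * (F₀ - Fh - ⟪K xh, y₀ - yh⟫)
      ≤ 1 / (2 * β) * ⟪T (x₀ - xh), x₀ - xh⟫ - 1 / (2 * β) * ⟪T (x₁ - xh), x₁ - xh⟫
        + 1 / 2 * ‖y₁ - yh‖ ^ 2 - 1 / 2 * ‖y₂ - yh‖ ^ 2 := by
  have e1 : σ * G₁ + 1 / β * ⟪T (x₀ - x₁), xh - x₁⟫ - σ * ⟪yb, K xh - K x₁⟫
      - σ * ⟪v, xh - x₁⟫ ≤ σ * Gh := by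
    have := mul_le_mul_of_nonneg_left hG hσ.le
    rw [inner_sub_left, inner_sub_left, real_inner_smul_left, real_inner_smul_left,
      ContinuousLinearMap.adjoint_inner_left, map_sub K] at this
    refine le_trans (le_of_eq ?_) this
    field_simp
    ring
  have e2 : σ * F₁ + θ * ⟪y₀ - y₁, y₂ - y₁⟫ + σ * ⟪K x₀, y₂ - y₁⟫ ≤ σ * F₂ := by
    have := mul_le_mul_of_nonneg_left hF₂ hσ.le
    rw [add_sub_right_comm, inner_add_left, real_inner_smul_left] at this
    refine le_trans (le_of_eq ?_) this
    rw [hθ]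
    field_simp
    ring
  have e3 : σ * θ * F₁ + θ ^ 2 * ⟪y₀ - y₁, y₀ - y₁⟫ + σ * θ * ⟪K x₀, y₀ - y₁⟫
      ≤ σ * θ * F₀ := by
    have := mul_le_mul_of_nonneg_left hF₀ (mul_nonneg hσ.le (hθ ▸ (div_pos hσ hσ').le : 0 ≤ θ))
    rw [add_sub_right_comm, inner_add_left, real_inner_smul_left] at this
    refine le_trans (le_of_eq ?_) this
    rw [hθ]
    field_simp
    ring
  have e4 : σ * F₂ + ⟪y₁ - y₂, yh - y₂⟫ + σ * ⟪K x₁, yh - y₂⟫ ≤ σ * Fh := by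
    have := mul_le_mul_of_nonneg_left hFh hσ.le
    rw [add_sub_right_comm, inner_add_left, real_inner_smul_left] at this
    refine le_trans (le_of_eq ?_) this
    field_simp
    ring
  have e5 := mul_le_mul_of_nonneg_left hh₀ hσ.le
  have e6 : 1 / 2 * σ ^ 2 * ⟪K x₁ - K x₀, K x₁ - K x₀⟫ + σ * (h₁ - h₀ - ⟪v, x₁ - x₀⟫)
      ≤ 1 / (2 * β) * ⟪T (x₁ - x₀), x₁ - x₀⟫ := by
    have := mul_le_mul_of_nonneg_left hls (by positivity : 0 ≤ 1 / (2 * β))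
    rw [← real_inner_self_eq_norm_sq] at this
    refine le_trans (le_of_eq ?_) this
    field_simp
  have e7 := real_inner_self_nonneg (x := σ • (K x₁ - K x₀) - (y₂ - yb))
  have e8 := mul_nonneg (sq_nonneg θ) (real_inner_self_nonneg (x := y₁ - y₀))
  have hβ2 : 1 / (2 * β) = 1 / 2 * (1 / β) := by field_simp
  rw [hβ2] at e6 ⊢
  rw [ContinuousLinearMap.adjoint_inner_left, map_sub K]
  subst hyb
  have hTc : ∀ u w : X, ⟪T u, w⟫ = ⟪T w, u⟫ := fun u w => by rw [hT, real_inner_comm]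
  simp only [← real_inner_self_eq_norm_sq, map_sub, inner_sub_left, inner_sub_right,
    inner_add_left, inner_add_right, real_inner_smul_left, real_inner_smul_right,
    hTc x₁ x₀, hTc xh x₀, hTc xh x₁,
    real_inner_comm y₀ y₁, real_inner_comm y₀ y₂,
    real_inner_comm y₁ y₂, real_inner_comm y₁ yh, real_inner_comm y₂ yh,
    real_inner_comm (K x₀) (K x₁),
    real_inner_comm y₀ (K x₀), real_inner_comm y₁ (K x₀), real_inner_comm y₂ (K x₀),
    real_inner_comm y₀ (K x₁), real_inner_comm y₁ (K x₁), real_inner_comm y₂ (K x₁), real_inner_comm yh (K x₁),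
    real_inner_comm y₀ (K xh), real_inner_comm y₁ (K xh), real_inner_comm yh (K xh)]
      at e1 e2 e3 e4 e5 e6 e7 e8 ⊢
  linear_combination e1 + e2 + e3 + e4 + e5 + e6 + 1 / 2 * e7 + 1 / 2 * e8

/-- A Gronwall-type estimate for a nonnegative sequence with perturbed descent. -/
theorem add_sum_le_prod_mul_of_le {W r η : ℕ → ℝ} (hη : ∀ k, 0 ≤ η k) (hr : ∀ k, 1 ≤ k → 0 ≤ r k)
    (hW : ∀ k, 1 ≤ k → W (k + 1) ≤ (1 + η k) * (W k - r k)) (N : ℕ) :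
    W (N + 1) + ∑ k ∈ Finset.Icc 1 N, r k ≤ (∏ k ∈ Finset.Icc 1 N, (1 + η k)) * W 1 := by
  induction N with
  | zero => simp
  | succ n ih =>
    rw [Finset.sum_Icc_succ_top (by omega), Finset.prod_Icc_succ_top (by omega)]
    have hs : 0 ≤ ∑ k ∈ Finset.Icc 1 n, r k :=
      Finset.sum_nonneg fun k hk => hr k (Finset.mem_Icc.1 hk).1
    have h1 := hW (n + 1) (by omega)
    have h2 := mul_le_mul_of_nonneg_left ih (add_nonneg zero_le_one (hη (n + 1)))
    have h3 := mul_nonneg (hη (n + 1)) (hr (n + 1) (by omega))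
    have h4 := mul_nonneg (hη (n + 1)) hs
    linear_combination h1 + h2 + h3 + h4

theorem prod_one_add_le_tprod {ι : Type*} {η : ι → ℝ} (hη : ∀ k, 0 ≤ η k) (hsum : Summable η)
    (s : Finset ι) : ∏ k ∈ s, (1 + η k) ≤ ∏' k, (1 + η k) := by
  have hm : Multipliable fun k => 1 + η k := Real.multipliable_one_add_of_summable hsum
  refine ge_of_tendsto hm.hasProd ?_
  filter_upwards [Filter.eventually_ge_atTop s] with t hst
  exact Finset.prod_le_prod_of_subset_of_one_le hst
    (fun i _ => add_nonneg zero_le_one (hη i)) (fun i _ _ => le_add_of_nonneg_right (hη i))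

theorem ConvexOn.sum_mul_map_le {E ι : Type*} [AddCommGroup E] [Module ℝ E] {s : Set E}
    {f : E → ℝ} (hf : ConvexOn ℝ s f) {t : Finset ι} {w : ι → ℝ} {p : ι → E}
    (hw : ∀ i ∈ t, 0 ≤ w i) (hpos : 0 < ∑ i ∈ t, w i) (hp : ∀ i ∈ t, p i ∈ s) :
    (∑ i ∈ t, w i) * f ((∑ i ∈ t, w i)⁻¹ • ∑ i ∈ t, w i • p i) ≤ ∑ i ∈ t, w i * f (p i) := by
  have := hf.map_centerMass_le hw hpos hp
  simp only [Finset.centerMass, smul_eq_mul, Function.comp_apply] at this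
  rwa [inv_mul_eq_div, le_div_iff₀' hpos] at this

theorem Convex.inv_sum_smul_mem {E ι : Type*} [AddCommGroup E] [Module ℝ E] {s : Set E}
    (hs : Convex ℝ s) {t : Finset ι} {w : ι → ℝ} {p : ι → E}
    (hw : ∀ i ∈ t, 0 ≤ w i) (hpos : 0 < ∑ i ∈ t, w i) (hp : ∀ i ∈ t, p i ∈ s) :
    (∑ i ∈ t, w i)⁻¹ • ∑ i ∈ t, w i • p i ∈ s :=
  hs.centerMass_mem hw hpos hp

/-- Summation by parts for the extrapolated points `v k + θ k • (v k - v (k - 1))`. -/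
theorem sum_smul_extrapolation {E : Type*} [AddCommGroup E] [Module ℝ E] {σ θ : ℕ → ℝ}
    {v vbar : ℕ → E} (hv : ∀ k, 1 ≤ k → vbar k = v k + θ k • (v k - v (k - 1))) (N : ℕ) :
    ∑ k ∈ Finset.Icc 1 N, (σ k * (1 + θ k) - σ (k + 1) * θ (k + 1)) • v k
        + (σ (N + 1) * θ (N + 1)) • v N
      = (σ 1 * θ 1) • v 0 + ∑ k ∈ Finset.Icc 1 N, σ k • vbar k := by
  induction N with
  | zero => simp
  | succ n ih =>
    rw [Finset.sum_Icc_succ_top (by omega), Finset.sum_Icc_succ_top (by omega), ← add_assoc, ← ih,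
      hv (n + 1) (by omega), Nat.add_sub_cancel]
    module

theorem IsSaddlePoint.ne_top {X Y : Type*}
    [NormedAddCommGroup X] [InnerProductSpace ℝ X]
    [NormedAddCommGroup Y] [InnerProductSpace ℝ Y]
    {K : X →L[ℝ] Y} {g : X → EReal} {h : X → ℝ} {fs : Y → EReal} {xh : X} {yh : Y}
    (hs : IsSaddlePoint K g h fs xh yh) (hgbot : ∀ z, g z ≠ ⊥) (hgtop : ∃ z, g z ≠ ⊤)
    (hfbot : ∀ z, fs z ≠ ⊥) (hftop : ∃ z, fs z ≠ ⊤) : g xh ≠ ⊤ ∧ fs yh ≠ ⊤ := by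
  obtain ⟨x, hx⟩ := hgtop
  obtain ⟨y, hy⟩ := hftop
  have hfin : ∀ u v, g u ≠ ⊤ → fs v ≠ ⊤ → saddleVal K g h fs u v
      = ((⟪K u, v⟫ + (g u).toReal + h u - (fs v).toReal : ℝ) : EReal) := by
    intro u v hu hv
    rw [saddleVal, ← EReal.coe_toReal hu (hgbot u), ← EReal.coe_toReal hv (hfbot v)]
    norm_cast
  have hyh : fs yh ≠ ⊤ := by
    intro htop
    have hbot : saddleVal K g h fs xh yh = ⊥ := by rw [saddleVal, htop, EReal.sub_top]
    have h1 := (hs x y).1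
    rw [hbot, le_bot_iff, saddleVal, ← EReal.coe_toReal hy (hfbot y), sub_eq_add_neg,
      EReal.add_eq_bot_iff, EReal.add_eq_bot_iff, EReal.add_eq_bot_iff] at h1
    rcases h1 with ((h1 | h1) | h1) | h1
    · exact EReal.coe_ne_bot _ h1
    · exact hgbot _ h1
    · exact EReal.coe_ne_bot _ h1
    · rw [← EReal.coe_neg] at h1
      exact EReal.coe_ne_bot _ h1
  refine ⟨fun htop => ?_, hyh⟩
  have h2 := (hs x yh).2
  rw [hfin x yh hx hyh, saddleVal, htop, EReal.coe_add_top, EReal.top_add_coe,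
    ← EReal.coe_toReal hyh (hfbot yh), EReal.top_sub_coe, top_le_iff] at h2
  exact EReal.coe_ne_top _ h2

theorem Pgap_eq_coe {X Y : Type*}
    [NormedAddCommGroup X] [InnerProductSpace ℝ X] [FiniteDimensional ℝ X]
    [NormedAddCommGroup Y] [InnerProductSpace ℝ Y] [FiniteDimensional ℝ Y]
    (K : X →L[ℝ] Y) {g : X → EReal} (h : X → ℝ) {xh : X} (yh : Y) {z : X}
    (hgbot : ∀ z, g z ≠ ⊥) (hxh : g xh ≠ ⊤) (hz : g z ≠ ⊤) :
    Pgap K g h xh yh z = (((g z).toReal + h z - (g xh).toReal - h xh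
      + ⟪(ContinuousLinearMap.adjoint K) yh, z - xh⟫ : ℝ) : EReal) := by
  rw [Pgap, ← EReal.coe_toReal hz (hgbot z), ← EReal.coe_toReal hxh (hgbot xh)]
  norm_cast

theorem Dgap_eq_coe {X Y : Type*}
    [NormedAddCommGroup X] [InnerProductSpace ℝ X]
    [NormedAddCommGroup Y] [InnerProductSpace ℝ Y]
    (K : X →L[ℝ] Y) {fs : Y → EReal} (xh : X) {yh z : Y}
    (hfbot : ∀ z, fs z ≠ ⊥) (hyh : fs yh ≠ ⊤) (hz : fs z ≠ ⊤) :
    Dgap K fs xh yh z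
      = (((fs z).toReal - (fs yh).toReal - ⟪K xh, z - yh⟫ : ℝ) : EReal) := by
  rw [Dgap, ← EReal.coe_toReal hz (hfbot z), ← EReal.coe_toReal hyh (hfbot yh)]
  norm_cast

/-- At a saddle point the primal gap is nonnegative. -/
theorem IsSaddlePoint.primal_gap_nonneg {X Y : Type*}
    [NormedAddCommGroup X] [InnerProductSpace ℝ X] [FiniteDimensional ℝ X]
    [NormedAddCommGroup Y] [InnerProductSpace ℝ Y] [FiniteDimensional ℝ Y]
    {K : X →L[ℝ] Y} {g : X → EReal} {h : X → ℝ} {fs : Y → EReal} {xh : X} {yh : Y}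
    (hs : IsSaddlePoint K g h fs xh yh) (hgbot : ∀ z, g z ≠ ⊥) (hfbot : ∀ z, fs z ≠ ⊥)
    (hxh : g xh ≠ ⊤) (hyh : fs yh ≠ ⊤) {z : X} (hz : g z ≠ ⊤) :
    0 ≤ (g z).toReal + h z - (g xh).toReal - h xh
      + ⟪(ContinuousLinearMap.adjoint K) yh, z - xh⟫ := by
  have h1 := (hs z yh).2
  rw [saddleVal, saddleVal, ← EReal.coe_toReal hz (hgbot z), ← EReal.coe_toReal hxh (hgbot xh),
    ← EReal.coe_toReal hyh (hfbot yh)] at h1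
  have h2 : ⟪K xh, yh⟫ + (g xh).toReal + h xh - (fs yh).toReal
      ≤ ⟪K z, yh⟫ + (g z).toReal + h z - (fs yh).toReal := by exact_mod_cast h1
  rw [ContinuousLinearMap.adjoint_inner_left, map_sub, inner_sub_right, real_inner_comm (K z),
    real_inner_comm (K xh)]
  linarith

/-- At a saddle point the dual gap is nonnegative. -/
theorem IsSaddlePoint.dual_gap_nonneg {X Y : Type*}
    [NormedAddCommGroup X] [InnerProductSpace ℝ X]
    [NormedAddCommGroup Y] [InnerProductSpace ℝ Y]
    {K : X →L[ℝ] Y} {g : X → EReal} {h : X → ℝ} {fs : Y → EReal} {xh : X} {yh : Y}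
    (hs : IsSaddlePoint K g h fs xh yh) (hgbot : ∀ z, g z ≠ ⊥) (hfbot : ∀ z, fs z ≠ ⊥)
    (hxh : g xh ≠ ⊤) (hyh : fs yh ≠ ⊤) {z : Y} (hz : fs z ≠ ⊤) :
    0 ≤ (fs z).toReal - (fs yh).toReal - ⟪K xh, z - yh⟫ := by
  have h1 := (hs xh z).1
  rw [saddleVal, saddleVal, ← EReal.coe_toReal hz (hfbot z), ← EReal.coe_toReal hxh (hgbot xh),
    ← EReal.coe_toReal hyh (hfbot yh)] at h1
  have h2 : ⟪K xh, z⟫ + (g xh).toReal + h xh - (fs z).toReal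
      ≤ ⟪K xh, yh⟫ + (g xh).toReal + h xh - (fs yh).toReal := by exact_mod_cast h1
  rw [inner_sub_right]
  linarith

theorem ConvexOn.primal_gap {X : Type*} [NormedAddCommGroup X] [InnerProductSpace ℝ X]
    {s : Set X} {G h : X → ℝ} (hG : ConvexOn ℝ s G) (hh : ConvexOn ℝ Set.univ h)
    (a b : ℝ) (u xh : X) :
    ConvexOn ℝ s (fun z => G z + h z - a - b + ⟪u, z - xh⟫) := by
  have hl : ConvexOn ℝ s (fun z => ⟪u, z⟫) := (innerₗ X u).convexOn hG.1
  have := ((hG.add (hh.subset (Set.subset_univ s) hG.1)).add hl).add_const (-a - b - ⟪u, xh⟫)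
  refine this.congr fun z _ => ?_
  simp only [Pi.add_apply, inner_sub_right]
  ring

theorem ConvexOn.dual_gap {Y : Type*} [NormedAddCommGroup Y] [InnerProductSpace ℝ Y]
    {s : Set Y} {F : Y → ℝ} (hF : ConvexOn ℝ s F) (a : ℝ) (u yh : Y) :
    ConvexOn ℝ s (fun z => F z - a - ⟪u, z - yh⟫) := by
  have hl : ConvexOn ℝ s (fun z => ⟪-u, z⟫) := (innerₗ Y (-u)).convexOn hF.1
  refine ((hF.add hl).add_const (-a + ⟪u, yh⟫)).congr fun z _ => ?_
  simp only [Pi.add_apply, inner_sub_right, inner_neg_left]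
  ring

/-- **Theorem 2.** Ergodic `O(1/N)` convergence rate of the
primal–dual gap for Algorithm 1 with constant ratio `β`, where
`D = Π_k (1+η_k) < ∞`, `s_N = Σ_{k=1}^N σ_k`, `X̄^N = (Σ_{k=1}^N σ_k x^{k+1})/s_N` and
`Ȳ^N = (σ_1θ_1 y^0 + Σ_{k=1}^N σ_k ȳ^k)/(σ_1θ_1 + s_N)`. -/
theorem ergodic_rate
    {X Y : Type*} [NormedAddCommGroup X] [InnerProductSpace ℝ X] [FiniteDimensional ℝ X]
    [NormedAddCommGroup Y] [InnerProductSpace ℝ Y] [FiniteDimensional ℝ Y]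
    (K : X →L[ℝ] Y)
    (g : X → EReal)
    (hgbot : ∀ z : X, g z ≠ ⊥) (hgtop : ∃ z : X, g z ≠ ⊤)
    (hglsc : LowerSemicontinuous g) (hgconv : ERealConvexOn g)
    (fs : Y → EReal)
    (hfbot : ∀ z : Y, fs z ≠ ⊥) (hftop : ∃ z : Y, fs z ≠ ⊤)
    (hflsc : LowerSemicontinuous fs) (hfconv : ERealConvexOn fs)
    (h : X → ℝ) (h' : X → X) (L : ℝ)
    (hhconv : ConvexOn ℝ Set.univ h)
    (hgrad : ∀ z : X, HasGradientAt h (h' z) z)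
    (hLip : ∀ u v : X, ‖h' u - h' v‖ ≤ L * ‖u - v‖)
    -- Assumption 1 on the metrics
    (α C_M : ℝ) (hα : 0 < α)
    (M Minv : ℕ → X →L[ℝ] X) (η : ℕ → ℝ)
    (hMsa : ∀ k, ∀ u v : X, ⟪M k u, v⟫ = ⟪u, M k v⟫)
    (hMα : ∀ k, ∀ z : X, α * ‖z‖ ^ 2 ≤ ⟪M k z, z⟫)
    (hMC : ∀ k, ‖M k‖ ≤ C_M)
    (hηnn : ∀ k, 0 ≤ η k) (hηsum : Summable η)
    (hMmono : ∀ k, ∀ z : X, ⟪M (k + 1) z, z⟫ ≤ (1 + η k) * ⟪M k z, z⟫)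
    (hMinv1 : ∀ k, (M k).comp (Minv k) = ContinuousLinearMap.id ℝ X)
    (hMinv2 : ∀ k, (Minv k).comp (M k) = ContinuousLinearMap.id ℝ X)
    -- step sizes
    (β δ σlb : ℝ) (hβ : 0 < β) (hδ : δ ∈ Set.Ioo (0 : ℝ) 1) (hσlb : 0 < σlb)
    (σ θ : ℕ → ℝ)
    (hσpos : ∀ k, 0 < σ k) (hσlbk : ∀ k, σlb ≤ σ k)
    (hθ0 : 0 ≤ θ 0)
    (hθ : ∀ k, 1 ≤ k → θ k = σ k / σ (k - 1))
    (hσub : ∀ k, 1 ≤ k → σ k ≤ Real.sqrt (1 + θ (k - 1)) * σ (k - 1))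
    -- the iterates of Algorithm 1
    (x : ℕ → X) (y : ℕ → Y) (ybar : ℕ → Y)
    (hy : ∀ k, 1 ≤ k →
      IsProxPt (1 : Y →L[ℝ] Y) (σ (k - 1)) fs (y (k - 1) + σ (k - 1) • K (x k)) (y k))
    (hybar : ∀ k, 1 ≤ k → ybar k = y k + θ k • (y k - y (k - 1)))
    (hx : ∀ k, 1 ≤ k →
      IsProxPt (M k) (β * σ k) g
        (x k - (β * σ k) • (Minv k) ((ContinuousLinearMap.adjoint K) (ybar k))
          - (β * σ k) • (Minv k) (h' (x k)))
        (x (k + 1)))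
    (hls : ∀ k, 1 ≤ k →
      (β * σ k) * σ k * ‖K (x (k + 1)) - K (x k)‖ ^ 2
          + 2 * (β * σ k) * (h (x (k + 1)) - h (x k) - ⟪h' (x k), x (k + 1) - x k⟫)
        ≤ δ * ⟪(M k) (x (k + 1) - x k), x (k + 1) - x k⟫)
    -- a saddle point
    (xh : X) (yh : Y) (hsaddle : IsSaddlePoint K g h fs xh yh)
    (hy0fin : fs (y 0) ≠ ⊤) :
    (∀ N : ℕ, 1 ≤ N →
      Pgap K g h xh yh
          ((∑ k ∈ Finset.Icc 1 N, σ k)⁻¹ • ∑ k ∈ Finset.Icc 1 N, σ k • x (k + 1))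
        + Dgap K fs xh yh
          ((σ 1 * θ 1 + ∑ k ∈ Finset.Icc 1 N, σ k)⁻¹ •
            ((σ 1 * θ 1) • y 0 + ∑ k ∈ Finset.Icc 1 N, σ k • ybar k))
      ≤ (((∏' j, (1 + η j)) / (∑ k ∈ Finset.Icc 1 N, σ k) : ℝ) : EReal) *
          (((1 / (2 * β) * ⟪M 1 (x 1 - xh), x 1 - xh⟫
              + 1 / 2 * ‖y 1 - yh‖ ^ 2 : ℝ) : EReal)
            + ((σ 1 * θ 1 : ℝ) : EReal) * Dgap K fs xh yh (y 0))) ∧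
    ∃ C : ℝ, ∀ N : ℕ, 1 ≤ N →
      Pgap K g h xh yh
          ((∑ k ∈ Finset.Icc 1 N, σ k)⁻¹ • ∑ k ∈ Finset.Icc 1 N, σ k • x (k + 1))
        + Dgap K fs xh yh
          ((σ 1 * θ 1 + ∑ k ∈ Finset.Icc 1 N, σ k)⁻¹ •
            ((σ 1 * θ 1) • y 0 + ∑ k ∈ Finset.Icc 1 N, σ k • ybar k))
      ≤ ((C / (N : ℝ) : ℝ) : EReal) := by
  obtain ⟨hxhfin, hyhfin⟩ := hsaddle.ne_top hgbot hgtop hfbot hftop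
  have hxfin : ∀ k, 1 ≤ k → g (x (k + 1)) ≠ ⊤ := fun k hk => (hx k hk).ne_top hxhfin
  have hyfin : ∀ k, fs (y k) ≠ ⊤ := by
    rintro (_ | k)
    · exact hy0fin
    · exact (hy (k + 1) (by omega)).ne_top hyhfin
  obtain ⟨P, hP⟩ : ∃ P : X → ℝ, P = fun z => (g z).toReal + h z - (g xh).toReal - h xh
      + ⟪(ContinuousLinearMap.adjoint K) yh, z - xh⟫ := ⟨_, rfl⟩
  obtain ⟨D, hD⟩ : ∃ D : Y → ℝ, D = fun z =>
      (fs z).toReal - (fs yh).toReal - ⟪K xh, z - yh⟫ := ⟨_, rfl⟩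
  have hPgap : ∀ z, g z ≠ ⊤ → Pgap K g h xh yh z = (P z : EReal) := fun z hz => by
    rw [hP]; exact Pgap_eq_coe K h yh hgbot hxhfin hz
  have hDgap : ∀ z, fs z ≠ ⊤ → Dgap K fs xh yh z = (D z : EReal) := fun z hz => by
    rw [hD]; exact Dgap_eq_coe K xh hfbot hyhfin hz
  have hPnn : ∀ z, g z ≠ ⊤ → 0 ≤ P z := fun z hz => by
    rw [hP]; exact hsaddle.primal_gap_nonneg hgbot hfbot hxhfin hyhfin hz
  have hDnn : ∀ z, fs z ≠ ⊤ → 0 ≤ D z := fun z hz => by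
    rw [hD]; exact hsaddle.dual_gap_nonneg hgbot hfbot hxhfin hyhfin hz
  have hPconv : ConvexOn ℝ {z | g z ≠ ⊤} P := by
    rw [hP]; exact (hgconv.convexOn_toReal hgbot).primal_gap hhconv _ _ _ _
  have hDconv : ConvexOn ℝ {z | fs z ≠ ⊤} D := by
    rw [hD]; exact (hfconv.convexOn_toReal hfbot).dual_gap _ _ _
  have hMnn : ∀ k, ∀ z : X, 0 ≤ ⟪M k z, z⟫ := fun k z =>
    (mul_nonneg hα.le (sq_nonneg _)).trans (hMα k z)
  have hθnn : ∀ k, 0 ≤ θ k := by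
    rintro (_ | k)
    · exact hθ0
    · rw [hθ (k + 1) (by omega)]; exact (div_pos (hσpos _) (hσpos _)).le
  -- the weights of the dual iterates produced by the extrapolation
  set c : ℕ → ℝ := fun k => σ k * (1 + θ k) - σ (k + 1) * θ (k + 1) with hc
  have hcnn : ∀ k, 0 ≤ c k := by
    intro k
    have h1 := hσub (k + 1) (by omega)
    rw [Nat.add_sub_cancel] at h1
    have h2 : σ (k + 1) ^ 2 ≤ (1 + θ k) * σ k ^ 2 := by
      have := pow_le_pow_left₀ (hσpos (k + 1)).le h1 2
      rwa [mul_pow, Real.sq_sqrt (add_nonneg zero_le_one (hθnn k))] at this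
    have h3 : σ (k + 1) * θ (k + 1) = σ (k + 1) ^ 2 / σ k := by
      rw [hθ (k + 1) (by omega), Nat.add_sub_cancel]; ring
    rw [hc]
    simp only
    rw [h3, sub_nonneg, div_le_iff₀ (hσpos k)]
    linarith
  -- the Lyapunov sequence and its decrease
  set W : ℕ → ℝ := fun k => 1 / (2 * β) * ⟪M k (x k - xh), x k - xh⟫
    + 1 / 2 * ‖y k - yh‖ ^ 2 + σ k * θ k * D (y (k - 1)) with hW
  set r : ℕ → ℝ := fun k => σ k * P (x (k + 1)) + c k * D (y k) with hr
  have hrnn : ∀ k, 1 ≤ k → 0 ≤ r k := fun k hk =>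
    add_nonneg (mul_nonneg (hσpos k).le (hPnn _ (hxfin k hk)))
      (mul_nonneg (hcnn k) (hDnn _ (hyfin k)))
  have hstep : ∀ k, 1 ≤ k → W (k + 1) ≤ (1 + η k) * (W k - r k) := by
    intro k hk
    have h1Q : ∀ u v : Y, ⟪(1 : Y →L[ℝ] Y) u, v⟫ = ⟪u, (1 : Y →L[ℝ] Y) v⟫ := fun _ _ => rfl
    have hMi : ∀ u, M k (Minv k u) = u := fun u =>
      congrArg (fun T : X →L[ℝ] X => T u) (hMinv1 k)
    have hG := (hx k hk).toReal_add_inner_le (mul_pos hβ (hσpos k)) (hMsa k) hgconv hgbot hxhfin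
    rw [sub_right_comm _ _ (x (k + 1)), sub_right_comm _ _ (x (k + 1)), map_sub, map_sub,
      map_smul, map_smul, hMi, hMi] at hG
    have hF := fun z hz =>
      (hy k hk).toReal_add_inner_le (z := z) (hσpos (k - 1)) h1Q hfconv hfbot hz
    have hFh := (hy (k + 1) (by omega)).toReal_add_inner_le (hσpos _) h1Q hfconv hfbot hyhfin
    rw [Nat.add_sub_cancel] at hFh
    have hdx := hMnn k (x (k + 1) - x k)
    have hmain := primal_dual_step K (M k) (hMsa k) (hσpos (k - 1)) (hσpos k) hβ (hθ k hk)
      (hybar k hk) hG (hF _ (hyfin (k + 1))) (hF _ (hyfin (k - 1))) hFh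
      (hhconv.add_inner_gradient_le (hgrad (x k)) xh)
      ((hls k hk).trans (mul_le_of_le_one_left hdx hδ.2.le))
    have hPx : P (x (k + 1)) = (g (x (k + 1))).toReal + h (x (k + 1)) - (g xh).toReal - h xh
      + ⟪(ContinuousLinearMap.adjoint K) yh, x (k + 1) - xh⟫ := by rw [hP]
    have hDy : ∀ z, D z = (fs z).toReal - (fs yh).toReal - ⟪K xh, z - yh⟫ := fun z => by rw [hD]
    rw [← hPx, ← hDy, ← hDy] at hmain
    have hbound : 1 / (2 * β) * ⟪M k (x (k + 1) - xh), x (k + 1) - xh⟫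
        + 1 / 2 * ‖y (k + 1) - yh‖ ^ 2 + σ (k + 1) * θ (k + 1) * D (y k) ≤ W k - r k := by
      simp only [hW, hr, hc]
      linear_combination hmain
    refine le_trans ?_ (mul_le_mul_of_nonneg_left hbound (add_nonneg zero_le_one (hηnn k)))
    have h1 := mul_le_mul_of_nonneg_left (hMmono k (x (k + 1) - xh))
      (by positivity : 0 ≤ 1 / (2 * β))
    have h2 : 0 ≤ η k * (1 / 2 * ‖y (k + 1) - yh‖ ^ 2) := mul_nonneg (hηnn k) (by positivity)
    have h3 : 0 ≤ η k * (σ (k + 1) * θ (k + 1) * D (y k)) := mul_nonneg (hηnn k)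
      (mul_nonneg (mul_nonneg (hσpos _).le (hθnn _)) (hDnn _ (hyfin k)))
    simp only [hW, Nat.add_sub_cancel]
    linear_combination h1 + h2 + h3
  have hWnn : ∀ k, σ k * θ k * D (y (k - 1)) ≤ W k := by
    intro k
    have h1 : 0 ≤ 1 / (2 * β) * ⟪M k (x k - xh), x k - xh⟫ :=
      mul_nonneg (by positivity) (hMnn k _)
    have h2 : 0 ≤ 1 / 2 * ‖y k - yh‖ ^ 2 := by positivity
    simp only [hW]
    linarith
  have hW1nn : 0 ≤ W 1 :=
    (mul_nonneg (mul_nonneg (hσpos 1).le (hθnn 1)) (hDnn _ (hyfin _))).trans (hWnn 1)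
  have hspos : ∀ N, 1 ≤ N → 0 < ∑ k ∈ Finset.Icc 1 N, σ k := fun N hN =>
    Finset.sum_pos (fun k _ => hσpos k) (Finset.nonempty_Icc.2 hN)
  have hgap : ∀ N : ℕ, 1 ≤ N →
      Pgap K g h xh yh
          ((∑ k ∈ Finset.Icc 1 N, σ k)⁻¹ • ∑ k ∈ Finset.Icc 1 N, σ k • x (k + 1))
        + Dgap K fs xh yh
          ((σ 1 * θ 1 + ∑ k ∈ Finset.Icc 1 N, σ k)⁻¹ •
            ((σ 1 * θ 1) • y 0 + ∑ k ∈ Finset.Icc 1 N, σ k • ybar k))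
      ≤ (((∏' j, (1 + η j)) / (∑ k ∈ Finset.Icc 1 N, σ k) * W 1 : ℝ) : EReal) := by
    intro N hN
    have hs := hspos N hN
    have hNmem : N ∈ Finset.Icc 1 N := Finset.mem_Icc.2 ⟨hN, le_rfl⟩
    have henn : 0 ≤ σ (N + 1) * θ (N + 1) := mul_nonneg (hσpos _).le (hθnn _)
    set w : ℕ → ℝ := fun k => c k + if k = N then σ (N + 1) * θ (N + 1) else 0 with hw
    have hwnn : ∀ k ∈ Finset.Icc 1 N, 0 ≤ w k := fun k _ =>
      add_nonneg (hcnn k) (by split_ifs <;> simp [henn])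
    have hwvec : ∑ k ∈ Finset.Icc 1 N, w k • y k
        = (σ 1 * θ 1) • y 0 + ∑ k ∈ Finset.Icc 1 N, σ k • ybar k := by
      rw [← sum_smul_extrapolation hybar N]
      simp [hw, hc, add_smul, Finset.sum_add_distrib, ite_smul, hN]
    have hwsum : ∑ k ∈ Finset.Icc 1 N, w k = σ 1 * θ 1 + ∑ k ∈ Finset.Icc 1 N, σ k := by
      have := sum_smul_extrapolation (E := ℝ) (σ := σ) (θ := θ) (v := fun _ => 1)
        (vbar := fun _ => 1) (by simp) N
      simp only [smul_eq_mul, mul_one] at this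
      rw [← this]
      simp [hw, hc, Finset.sum_add_distrib, hN]
    have hwD : ∑ k ∈ Finset.Icc 1 N, w k * D (y k)
        = ∑ k ∈ Finset.Icc 1 N, c k * D (y k) + σ (N + 1) * θ (N + 1) * D (y N) := by
      simp [hw, add_mul, Finset.sum_add_distrib, ite_mul, hN]
    have hσθ : 0 ≤ σ 1 * θ 1 := mul_nonneg (hσpos 1).le (hθnn 1)
    have hwpos : 0 < ∑ k ∈ Finset.Icc 1 N, w k := by rw [hwsum]; linarith
    have hxmem : ∀ k ∈ Finset.Icc 1 N, x (k + 1) ∈ {z | g z ≠ ⊤} := fun k hk =>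
      hxfin k (Finset.mem_Icc.1 hk).1
    have hymem : ∀ k ∈ Finset.Icc 1 N, y k ∈ {z | fs z ≠ ⊤} := fun k _ => hyfin k
    have hXfin := hPconv.1.inv_sum_smul_mem (fun k _ => (hσpos k).le) hs hxmem
    have hYfin := hDconv.1.inv_sum_smul_mem hwnn hwpos hymem
    have hXle := hPconv.sum_mul_map_le (fun k _ => (hσpos k).le) hs hxmem
    have hYle := hDconv.sum_mul_map_le hwnn hwpos hymem
    rw [hwD] at hYle
    rw [hwsum, hwvec] at hYle hYfin
    rw [hPgap _ hXfin, hDgap _ hYfin]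
    have hDY := mul_nonneg hσθ (hDnn _ hYfin)
    have hsum := add_sum_le_prod_mul_of_le hηnn hrnn hstep N
    have hprod := mul_le_mul_of_nonneg_right
      (prod_one_add_le_tprod hηnn hηsum (Finset.Icc 1 N)) hW1nn
    have hWN := hWnn (N + 1)
    rw [Nat.add_sub_cancel] at hWN
    simp only [hr, Finset.sum_add_distrib] at hsum
    rw [← EReal.coe_add, EReal.coe_le_coe_iff, div_mul_eq_mul_div, le_div_iff₀ hs]
    linarith
  refine ⟨fun N hN => (hgap N hN).trans (le_of_eq ?_),
    (∏' j, (1 + η j)) * W 1 / σlb, fun N hN => (hgap N hN).trans ?_⟩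
  · rw [hDgap _ (hyfin 0)]
    norm_cast
  · rw [EReal.coe_le_coe_iff, div_mul_eq_mul_div, div_div]
    have hDnn' : 0 ≤ ∏' j, (1 + η j) := by
      have := prod_one_add_le_tprod hηnn hηsum ∅
      rw [Finset.prod_empty] at this
      linarith
    have hNpos : (0 : ℝ) < N := by exact_mod_cast hN
    have hsN : σlb * N ≤ ∑ k ∈ Finset.Icc 1 N, σ k := by
      have := Finset.card_nsmul_le_sum (Finset.Icc 1 N) σ σlb fun k _ => hσlbk k
      simpa [mul_comm] using this
    exact div_le_div_of_nonneg_left (mul_nonneg hDnn' hW1nn) (mul_pos hσlb hNpos) hsN
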